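/- arXiv:2409.08727 — 2 statements merged into one kernel-verified Lean document; each statement's English description precedes it below -/
import Mathlib

section
/- Let Σ be a ranked alphabet and let B be a strong bimonoid. If B is positive or distributive (i.e. both left- and right-distributive), then for each weighted tree automaton A over Σ and B, supp(⟦A⟧^run) = supp(⟦A⟧^init). -/
/-! Strong bimonoids -/

structure StrongBimonoid (B : Type) where
  add : B → B → B
  mul : B → B → B
  zero : B
  one : B
  add_assoc : ∀ a b c, add (add a b) c = add a (add b c)
  add_comm : ∀ a b, add a b = add b a
  add_zero : ∀ a, add a zero = a
  mul_assoc : ∀ a b c, mul (mul a b) c = mul a (mul b c)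
  one_mul : ∀ a, mul one a = a
  mul_one : ∀ a, mul a one = a
  zero_mul : ∀ a, mul zero a = zero
  mul_zero : ∀ a, mul a zero = zero

namespace StrongBimonoid

variable {B : Type} (S : StrongBimonoid B)

/-- The additive commutative monoid underlying a strong bimonoid. -/
def acm : AddCommMonoid B where
  add := S.add
  zero := S.zero
  add_assoc := S.add_assoc
  zero_add := fun a => (S.add_comm S.zero a).trans (S.add_zero a)
  add_zero := S.add_zero
  add_comm := S.add_comm
  nsmul := fun n a => Nat.rec S.zero (fun _ ih => S.add ih a) n
  nsmul_zero := fun _ => rfl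
  nsmul_succ := fun _ _ => rfl

/-- Finite sum (w.r.t. `S.add`, `S.zero`) of `f` over a finite index set. -/
def fsum {ι : Type} (t : Finset ι) (f : ι → B) : B :=
  @Finset.sum ι B S.acm t f

/-- Ordered product `f 0 ⊗ f 1 ⊗ ⋯ ⊗ f (k-1)` (empty product is `S.one`). -/
def finProd : {k : ℕ} → (Fin k → B) → B
  | 0, _ => S.one
  | _ + 1, f => S.mul (f 0) (finProd (fun i => f i.succ))

def ZeroSumFree : Prop :=
  ∀ a b, S.add a b = S.zero → a = S.zero ∧ b = S.zero

def StronglyZeroSumFree : Prop :=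
  ∀ a b c, S.mul (S.add a b) c = S.zero ↔ (S.mul a c = S.zero ∧ S.mul b c = S.zero)

def BiStronglyZeroSumFree : Prop :=
  ∀ a b b' c, S.mul (S.mul a (S.add b b')) c = S.zero ↔
    (S.mul (S.mul a b) c = S.zero ∧ S.mul (S.mul a b') c = S.zero)

def ZeroDivisorFree : Prop :=
  ∀ a b, S.mul a b = S.zero ↔ (a = S.zero ∨ b = S.zero)

def Positive : Prop := S.ZeroSumFree ∧ S.ZeroDivisorFree

def RightDistributive : Prop :=
  ∀ a b c, S.mul (S.add a b) c = S.add (S.mul a c) (S.mul b c)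

def LeftDistributive : Prop :=
  ∀ a b c, S.mul a (S.add b c) = S.add (S.mul a b) (S.mul a c)

def ZeroRightDistributive : Prop :=
  ∀ a b c, (S.mul (S.add a b) c = S.zero ↔ S.add (S.mul a c) (S.mul b c) = S.zero)

def CommutativeMul : Prop := ∀ a b, S.mul a b = S.mul b a

end StrongBimonoid

/-! Weighted automata over words -/

section Word

variable {B : Type} {Γ : Type} {Q : Type}

/-- The product `μ(a₁)_{ρ₀,ρ₁} ⊗ ⋯ ⊗ μ(aₙ)_{ρₙ₋₁,ρₙ}` of the transition weights
along the run `ρ` on the word `w = a₁⋯aₙ`. -/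
def transProd (S : StrongBimonoid B) (μ : Γ → Q → Q → B) :
    (w : List Γ) → (Fin (w.length + 1) → Q) → B
  | [], _ => S.one
  | a :: w, ρ => S.mul (μ a (ρ 0) (ρ 1)) (transProd S μ w (fun i => ρ i.succ))

/-- Run semantics of the weighted automaton `(Q, I, μ, F)` over `Γ` and `S`. -/
def runSem (S : StrongBimonoid B) [Fintype Q] (I : Q → B) (μ : Γ → Q → Q → B)
    (F : Q → B) (w : List Γ) : B :=
  S.fsum Finset.univ (fun ρ : Fin (w.length + 1) → Q =>
    S.mul (S.mul (I (ρ 0)) (transProd S μ w ρ)) (F (ρ (Fin.last w.length))))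

/-- `hWord S μ w v` is the vector `v ⊗ μ(a₁) ⊗ ⋯ ⊗ μ(aₙ)` (left-associated
vector-matrix products) for `w = a₁⋯aₙ`. -/
def hWord (S : StrongBimonoid B) [Fintype Q] (μ : Γ → Q → Q → B) :
    List Γ → (Q → B) → (Q → B)
  | [], v => v
  | a :: w, v =>
      hWord S μ w (fun q => S.fsum Finset.univ (fun p => S.mul (v p) (μ a p q)))

/-- Initial algebra semantics of the weighted automaton `(Q, I, μ, F)`. -/
def initSem (S : StrongBimonoid B) [Fintype Q] (I : Q → B) (μ : Γ → Q → Q → B)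
    (F : Q → B) (w : List Γ) : B :=
  S.fsum Finset.univ (fun q => S.mul (hWord S μ w I q) (F q))

end Word

/-! Ranked alphabets, trees and weighted tree automata -/

/-- Trees over the ranked alphabet `(σ, rk)`: a node labelled `s` has exactly
`rk s` children. -/
inductive RTree (σ : Type) (rk : σ → ℕ) : Type where
  | node (s : σ) (ts : Fin (rk s) → RTree σ rk) : RTree σ rk

/-- The ranked alphabet is trivial if all symbols have rank 0. -/
def RankTrivial {σ : Type} (rk : σ → ℕ) : Prop := ∀ s, rk s = 0

/-- The ranked alphabet is branching if some symbol has rank ≥ 2. -/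
def RankBranching {σ : Type} (rk : σ → ℕ) : Prop := ∃ s, 2 ≤ rk s

/-- A run of an automaton with state set `Q` on a tree: an assignment of a
state to every position of the tree. -/
inductive TreeRun (σ : Type) (rk : σ → ℕ) (Q : Type) : RTree σ rk → Type where
  | node {s : σ} {ts : Fin (rk s) → RTree σ rk} (q : Q)
      (rs : (i : Fin (rk s)) → TreeRun σ rk Q (ts i)) :
      TreeRun σ rk Q (RTree.node s ts)

/-- The state assigned by a run to the root. -/
def TreeRun.root {σ : Type} {rk : σ → ℕ} {Q : Type} {t : RTree σ rk} :
    TreeRun σ rk Q t → Q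
  | .node q _ => q

def treeRunFintype {σ : Type} {rk : σ → ℕ} (Q : Type) [Fintype Q] :
    (t : RTree σ rk) → Fintype (TreeRun σ rk Q t)
  | RTree.node s ts =>
    letI : ∀ i, Fintype (TreeRun σ rk Q (ts i)) := fun i => treeRunFintype Q (ts i)
    Fintype.ofEquiv (Q × ((i : Fin (rk s)) → TreeRun σ rk Q (ts i)))
      { toFun := fun p => TreeRun.node p.1 p.2
        invFun := fun r => match r with | TreeRun.node q rs => (q, rs)
        left_inv := fun _ => rfl
        right_inv := fun r => match r with | TreeRun.node _ _ => rfl }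

instance {σ : Type} {rk : σ → ℕ} {Q : Type} [Fintype Q] (t : RTree σ rk) :
    Fintype (TreeRun σ rk Q t) := treeRunFintype Q t

/-- The weight of a run on a tree. -/
def treeWt {B : Type} {σ : Type} {rk : σ → ℕ} {Q : Type} (S : StrongBimonoid B)
    (δ : (s : σ) → (Fin (rk s) → Q) → Q → B) :
    (t : RTree σ rk) → TreeRun σ rk Q t → B
  | _, TreeRun.node (s := s) (ts := ts) q rs =>
      S.mul (S.finProd (fun i => treeWt S δ (ts i) (rs i)))
        (δ s (fun i => (rs i).root) q)

/-- Run semantics of the weighted tree automaton `(Q, δ, F)`. -/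
def treeRunSem {B : Type} {σ : Type} {rk : σ → ℕ} {Q : Type} (S : StrongBimonoid B)
    [Fintype Q] (δ : (s : σ) → (Fin (rk s) → Q) → Q → B) (F : Q → B)
    (t : RTree σ rk) : B :=
  S.fsum Finset.univ (fun ρ : TreeRun σ rk Q t => S.mul (treeWt S δ t ρ) (F ρ.root))

/-- The map `h_A : T_Σ → B^Q` of the initial algebra semantics. -/
def treeH {B : Type} {σ : Type} {rk : σ → ℕ} {Q : Type} (S : StrongBimonoid B)
    [Fintype Q] (δ : (s : σ) → (Fin (rk s) → Q) → Q → B) :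
    RTree σ rk → Q → B
  | RTree.node s ts => fun q =>
      S.fsum Finset.univ (fun qs : Fin (rk s) → Q =>
        S.mul (S.finProd (fun i => treeH S δ (ts i) (qs i))) (δ s qs q))

/-- Initial algebra semantics of the weighted tree automaton `(Q, δ, F)`. -/
def treeInitSem {B : Type} {σ : Type} {rk : σ → ℕ} {Q : Type} (S : StrongBimonoid B)
    [Fintype Q] (δ : (s : σ) → (Fin (rk s) → Q) → Q → B) (F : Q → B)
    (t : RTree σ rk) : B :=
  S.fsum Finset.univ (fun q => S.mul (treeH S δ t q) (F q))

/-- The semiring structure of a distributive strong bimonoid. -/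
abbrev StrongBimonoid.semiring {B : Type} (S : StrongBimonoid B)
    (hl : S.LeftDistributive) (hr : S.RightDistributive) : Semiring B :=
  { S.acm with
    mul := S.mul
    one := S.one
    mul_assoc := S.mul_assoc
    one_mul := S.one_mul
    mul_one := S.mul_one
    zero_mul := S.zero_mul
    mul_zero := S.mul_zero
    left_distrib := hl
    right_distrib := hr }

/-- A run on a tree is a root state together with runs on the direct subtrees. -/
def treeRunEquiv {σ : Type} {rk : σ → ℕ} (Q : Type) (s : σ) (ts : Fin (rk s) → RTree σ rk) :
    (Q × ((i : Fin (rk s)) → TreeRun σ rk Q (ts i))) ≃ TreeRun σ rk Q (RTree.node s ts) where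
  toFun p := TreeRun.node p.1 p.2
  invFun r := match r with | TreeRun.node q rs => (q, rs)
  left_inv _ := rfl
  right_inv r := match r with | TreeRun.node _ _ => rfl

namespace StrongBimonoid

/-- If single weighted sums over `Q` and over `R i` agree, so do the sums over tuples. -/
theorem sum_finProd_mul_eq {B : Type} (S : StrongBimonoid B)
    (hl : S.LeftDistributive) (hr : S.RightDistributive) {Q : Type} [Fintype Q] {k : ℕ}
    (R : Fin k → Type) [∀ i, Fintype (R i)] (h : Fin k → Q → B) (w : ∀ i, R i → B)
    (root : ∀ i, R i → Q)
    (H : ∀ i (G : Q → B), S.fsum Finset.univ (fun q => S.mul (h i q) (G q)) =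
      S.fsum Finset.univ (fun r => S.mul (w i r) (G (root i r))))
    (K : (Fin k → Q) → B) :
    S.fsum Finset.univ (fun qs : Fin k → Q => S.mul (S.finProd fun i => h i (qs i)) (K qs)) =
      S.fsum Finset.univ (fun rs : (i : Fin k) → R i =>
        S.mul (S.finProd fun i => w i (rs i)) (K fun i => root i (rs i))) := by
  let _ := S.semiring hl hr
  induction k with
  | zero =>
    change ∑ _, _ = ∑ _, _
    rw [Fintype.sum_unique, Fintype.sum_unique]
    exact congrArg _ (congrArg K (Subsingleton.elim _ _))
  | succ k ih =>
    have ih' (q : Q) := ih (fun i => R i.succ) (fun i => h i.succ) (fun i => w i.succ)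
      (fun i => root i.succ) (fun i => H i.succ) (fun qs => K (Fin.cons q qs))
    have key := H 0 fun q => S.fsum Finset.univ fun qs : Fin k → Q =>
      S.mul (S.finProd fun i => h i.succ (qs i)) (K (Fin.cons q qs))
    simp only [ih'] at key
    have e1 := (Fin.consEquiv fun _ : Fin (k + 1) => Q).sum_comp
      fun qs => S.mul (S.finProd fun i => h i (qs i)) (K qs)
    have e2 := (Fin.consEquiv R).sum_comp
      fun rs => S.mul (S.finProd fun i => w i (rs i)) (K fun i => root i (rs i))
    refine e1.symm.trans (Eq.trans ?_ e2)
    rw [Fintype.sum_prod_type, Fintype.sum_prod_type]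
    have l (q : Q) : ∑ qs : Fin k → Q, S.mul (S.finProd fun i =>
        h i ((Fin.consEquiv fun _ : Fin (k + 1) => Q) (q, qs) i))
          (K ((Fin.consEquiv fun _ : Fin (k + 1) => Q) (q, qs))) =
        S.mul (h 0 q) (S.fsum Finset.univ fun qs : Fin k → Q =>
          S.mul (S.finProd fun i => h i.succ (qs i)) (K (Fin.cons q qs))) := by
      refine Eq.trans (Finset.sum_congr rfl fun qs _ => ?_) (Finset.mul_sum ..).symm
      exact S.mul_assoc ..
    have r (x : R 0) : ∑ rs : (i : Fin k) → R i.succ, S.mul (S.finProd fun i =>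
        w i (Fin.consEquiv R (x, rs) i)) (K fun i => root i (Fin.consEquiv R (x, rs) i)) =
        S.mul (w 0 x) (S.fsum Finset.univ fun rs : (i : Fin k) → R i.succ =>
          S.mul (S.finProd fun i => w i.succ (rs i))
            (K (Fin.cons (root 0 x) fun i => root i.succ (rs i)))) := by
      refine Eq.trans (Finset.sum_congr rfl fun rs _ => ?_) (Finset.mul_sum ..).symm
      refine (S.mul_assoc ..).trans (congrArg _ (congrArg _ (congrArg K ?_)))
      funext i
      refine Fin.cases ?_ (fun _ => ?_) i <;> rfl
    simp only [l, r, ih']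
    exact key

theorem Positive.fsum_ne_zero_iff {B : Type} {S : StrongBimonoid B} (hS : S.Positive)
    {ι : Type} (t : Finset ι) (f : ι → B) :
    S.fsum t f ≠ S.zero ↔ ∃ i ∈ t, f i ≠ S.zero := by
  classical
  let _ := S.acm
  induction t using Finset.induction_on with
  | empty => exact iff_of_false (fun h => h rfl) (by simp)
  | insert a t ha ih =>
    have e : S.fsum (insert a t) f = S.add (f a) (S.fsum t f) := Finset.sum_insert ha
    have hz : S.add (f a) (S.fsum t f) ≠ S.zero ↔ f a ≠ S.zero ∨ S.fsum t f ≠ S.zero := by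
      rw [← not_and_or, not_iff_not]
      refine ⟨hS.1 _ _, fun ⟨h, h'⟩ => ?_⟩
      rw [h, h', S.add_zero]
    simp [e, hz, ih]

theorem Positive.mul_ne_zero_iff {B : Type} {S : StrongBimonoid B} (hS : S.Positive) {a b : B} :
    S.mul a b ≠ S.zero ↔ a ≠ S.zero ∧ b ≠ S.zero := by
  rw [Ne, hS.2, not_or]

theorem Positive.finProd_ne_zero_iff {B : Type} {S : StrongBimonoid B} (hS : S.Positive)
    (h1 : S.one ≠ S.zero) {k : ℕ} (f : Fin k → B) :
    S.finProd f ≠ S.zero ↔ ∀ i, f i ≠ S.zero := by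
  induction k with
  | zero => exact iff_of_true h1 (fun i => i.elim0)
  | succ k ih => rw [finProd, hS.mul_ne_zero_iff, ih, Fin.forall_fin_succ]

theorem eq_zero_of_one_eq_zero {B : Type} (S : StrongBimonoid B) (h1 : S.one = S.zero) (a : B) :
    a = S.zero := by
  rw [← S.mul_one a, h1, S.mul_zero]

end StrongBimonoid

/-- The two semantics agree in the distributive case. -/
theorem treeInitSem_eq_treeRunSem {B σ Q : Type} {rk : σ → ℕ} (S : StrongBimonoid B)
    (hl : S.LeftDistributive) (hr : S.RightDistributive) [Fintype Q]
    (δ : (s : σ) → (Fin (rk s) → Q) → Q → B) (t : RTree σ rk) (G : Q → B) :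
    treeInitSem S δ G t = treeRunSem S δ G t := by
  let _ := S.semiring hl hr
  induction t generalizing G with
  | node s ts ih =>
    have e := (treeRunEquiv Q s ts).sum_comp fun ρ => S.mul (treeWt S δ _ ρ) (G ρ.root)
    refine Eq.trans ?_ e
    rw [Fintype.sum_prod_type]
    refine Finset.sum_congr rfl fun q _ => ?_
    refine Eq.trans (Finset.sum_mul ..) ?_
    refine Eq.trans (Finset.sum_congr rfl fun qs _ => S.mul_assoc ..) ?_
    refine (S.sum_finProd_mul_eq hl hr (fun i => TreeRun σ rk Q (ts i))
      (fun i => treeH S δ (ts i)) (fun i => treeWt S δ (ts i)) (fun _ => TreeRun.root)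
      ih (fun qs => S.mul (δ s qs q) (G q))).trans ?_
    exact Finset.sum_congr rfl fun rs _ => (S.mul_assoc ..).symm

/-- In the positive case, `treeH` is nonzero at a state exactly when that state is the root of
a run of nonzero weight. -/
theorem StrongBimonoid.Positive.treeH_ne_zero_iff {B σ Q : Type} {rk : σ → ℕ}
    {S : StrongBimonoid B} (hS : S.Positive) (h1 : S.one ≠ S.zero) [Fintype Q]
    (δ : (s : σ) → (Fin (rk s) → Q) → Q → B) (t : RTree σ rk) (q : Q) :
    treeH S δ t q ≠ S.zero ↔ ∃ ρ : TreeRun σ rk Q t, ρ.root = q ∧ treeWt S δ t ρ ≠ S.zero := by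
  induction t generalizing q with
  | node s ts ih =>
    simp only [treeH, hS.fsum_ne_zero_iff, hS.mul_ne_zero_iff, hS.finProd_ne_zero_iff h1, ih,
      Finset.mem_univ, true_and]
    constructor
    · rintro ⟨qs, hqs, hδ⟩
      choose rs hroot hwt using hqs
      obtain rfl : (fun i => (rs i).root) = qs := funext hroot
      refine ⟨.node q rs, rfl, ?_⟩
      simp only [treeWt, hS.mul_ne_zero_iff, hS.finProd_ne_zero_iff h1]
      exact ⟨hwt, hδ⟩
    · rintro ⟨⟨q', rs⟩, rfl, hwt⟩
      simp only [treeWt, hS.mul_ne_zero_iff, hS.finProd_ne_zero_iff h1] at hwt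
      exact ⟨fun i => (rs i).root, fun i => ⟨rs i, rfl, hwt.1 i⟩, hwt.2⟩

theorem stmt16 {B : Type} (S : StrongBimonoid B)
    (σt : Type) [Fintype σt] [Nonempty σt] (rk : σt → ℕ) (h0 : ∃ s, rk s = 0)
    (h : S.Positive ∨ (S.LeftDistributive ∧ S.RightDistributive)) :
    ∀ (Q : Type) [Fintype Q] [Nonempty Q] (δ : (s : σt) → (Fin (rk s) → Q) → Q → B) (F : Q → B),
      {t : RTree σt rk | treeRunSem S δ F t ≠ S.zero} =
        {t : RTree σt rk | treeInitSem S δ F t ≠ S.zero} := by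
  intro Q _ _ δ F
  ext t
  rcases h with hS | ⟨hl, hr⟩
  · by_cases h1 : S.one = S.zero
    · exact iff_of_false (fun h => h (S.eq_zero_of_one_eq_zero h1 _))
        (fun h => h (S.eq_zero_of_one_eq_zero h1 _))
    · simp only [Set.mem_ofPred_eq, treeRunSem, treeInitSem, hS.fsum_ne_zero_iff,
        hS.mul_ne_zero_iff, hS.treeH_ne_zero_iff h1, Finset.mem_univ, true_and]
      constructor
      · rintro ⟨ρ, hw, hF⟩
        exact ⟨ρ.root, ⟨ρ, rfl, hw⟩, hF⟩
      · rintro ⟨_, ⟨ρ, rfl, hw⟩, hF⟩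
        exact ⟨ρ, hw, hF⟩
  · rw [Set.mem_ofPred_eq, Set.mem_ofPred_eq, treeInitSem_eq_treeRunSem S hl hr]
end

section
/- Let Σ be a ranked alphabet and B be a strong bimonoid. The following two statements are equivalent: (1) if Σ is not trivial then B is right-distributive, and if Σ is branching then B is left-distributive; (2) for each weighted tree automaton A over Σ and B, ⟦A⟧^run = ⟦A⟧^init. -/
namespace StrongBimonoid

variable {B : Type} (S : StrongBimonoid B)

section Sums

variable {ι κ : Type} [Fintype ι] [Fintype κ]

theorem fsum_congr {f g : ι → B} (h : ∀ i, f i = g i) :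
    S.fsum Finset.univ f = S.fsum Finset.univ g := by
  rw [funext h]

theorem fsum_equiv (e : ι ≃ κ) (f : ι → B) (g : κ → B) (h : ∀ i, f i = g (e i)) :
    S.fsum Finset.univ f = S.fsum Finset.univ g :=
  letI := S.acm
  Fintype.sum_equiv e f g h

theorem fsum_prod (f : ι × κ → B) :
    S.fsum Finset.univ f =
      S.fsum Finset.univ (fun i => S.fsum Finset.univ (fun j => f (i, j))) :=
  letI := S.acm
  Fintype.sum_prod_type f

theorem fsum_comm (f : ι → κ → B) :
    S.fsum Finset.univ (fun i => S.fsum Finset.univ (fun j => f i j)) =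
      S.fsum Finset.univ (fun j => S.fsum Finset.univ (fun i => f i j)) :=
  letI := S.acm
  Finset.sum_comm

theorem fsum_unique [Unique ι] (f : ι → B) : S.fsum Finset.univ f = f default :=
  letI := S.acm
  Fintype.sum_unique f

theorem fsum_eq_single {f : ι → B} (x : ι) (h : ∀ y, y ≠ x → f y = S.zero) :
    S.fsum Finset.univ f = f x :=
  letI := S.acm
  Fintype.sum_eq_single x h

theorem fsum_eq_add {f : ι → B} (x y : ι) (hxy : x ≠ y)
    (h : ∀ z, z ≠ x ∧ z ≠ y → f z = S.zero) :
    S.fsum Finset.univ f = S.add (f x) (f y) :=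
  letI := S.acm
  Fintype.sum_eq_add x y hxy h

variable {S}

theorem RightDistributive.fsum_mul (hr : S.RightDistributive) (f : ι → B) (c : B) :
    S.mul (S.fsum Finset.univ f) c = S.fsum Finset.univ (fun i => S.mul (f i) c) :=
  letI := S.acm
  map_sum ({ toFun := fun a => S.mul a c
             map_zero' := S.zero_mul c
             map_add' := fun a b => hr a b c } : B →+ B) f Finset.univ

theorem LeftDistributive.mul_fsum (hl : S.LeftDistributive) (f : ι → B) (c : B) :
    S.mul c (S.fsum Finset.univ f) = S.fsum Finset.univ (fun i => S.mul c (f i)) :=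
  letI := S.acm
  map_sum ({ toFun := fun a => S.mul c a
             map_zero' := S.mul_zero c
             map_add' := fun a b => hl c a b } : B →+ B) f Finset.univ

end Sums

theorem finProd_eq_one {k : ℕ} {f : Fin k → B} (h : ∀ i, f i = S.one) :
    S.finProd f = S.one := by
  induction k with
  | zero => rfl
  | succ k ih => rw [finProd, h 0, S.one_mul]; exact ih fun i => h i.succ

theorem finProd_eq_zero {k : ℕ} {f : Fin k → B} (i : Fin k) (h : f i = S.zero) :
    S.finProd f = S.zero := by
  induction k with
  | zero => exact i.elim0
  | succ k ih =>
    rw [finProd]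
    cases i using Fin.cases with
    | zero => rw [h, S.zero_mul]
    | succ j => rw [ih (f := fun i => f i.succ) j h, S.mul_zero]

theorem finProd_eq_head {k : ℕ} (hk : 1 ≤ k) {f : Fin k → B}
    (h : ∀ i : Fin k, 1 ≤ i.val → f i = S.one) : S.finProd f = f ⟨0, hk⟩ := by
  obtain ⟨m, rfl⟩ := Nat.exists_eq_add_of_le' hk
  rw [finProd, S.finProd_eq_one fun i => h i.succ (by simp), S.mul_one]
  rfl

theorem finProd_eq_mul {k : ℕ} (hk : 2 ≤ k) {f : Fin k → B}
    (h : ∀ i : Fin k, 2 ≤ i.val → f i = S.one) :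
    S.finProd f = S.mul (f ⟨0, by omega⟩) (f ⟨1, by omega⟩) := by
  obtain ⟨m, rfl⟩ := Nat.exists_eq_add_of_le' hk
  rw [finProd, S.finProd_eq_head (by omega) fun i hi => h i.succ (by simpa using hi)]
  rfl

theorem finProd_ite {k : ℕ} (p : Fin k → Prop) [DecidablePred p] [Decidable (∀ i, p i)]
    (f : Fin k → B) :
    S.finProd (fun i => if p i then f i else S.zero) =
      if ∀ i, p i then S.finProd f else S.zero := by
  split_ifs with h
  · simp [h]
  · obtain ⟨i, hi⟩ := not_forall.mp h
    exact S.finProd_eq_zero i (if_neg hi)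

variable {S}

theorem finProd_fsum {k : ℕ} (hr : 1 ≤ k → S.RightDistributive)
    (hl : 2 ≤ k → S.LeftDistributive) {ι : Fin k → Type} [∀ i, Fintype (ι i)]
    (f : ∀ i, ι i → B) :
    S.finProd (fun i => S.fsum Finset.univ (f i)) =
      S.fsum Finset.univ (fun r : ∀ i, ι i => S.finProd (fun i => f i (r i))) := by
  induction k with
  | zero => exact (S.fsum_unique (fun r : ∀ i, ι i => S.finProd fun i => f i (r i))).symm
  | succ k ih =>
    have hr' := hr (by omega)
    rw [finProd, ih (fun _ => hr') (fun _ => hl (by omega)), hr'.fsum_mul]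
    rw [← S.fsum_equiv (Fin.consEquiv ι) (fun p => S.mul (f 0 p.1)
      (S.finProd (fun i => f i.succ (p.2 i)))) _ (fun _ => rfl), S.fsum_prod]
    refine S.fsum_congr fun r => ?_
    rcases k with _ | k
    · rw [S.fsum_unique, S.fsum_unique]
    · exact (hl (by omega)).mul_fsum _ _

end StrongBimonoid

section Trees

variable {B σ Q : Type} {rk : σ → ℕ} {S : StrongBimonoid B}

/-- A run on `s(ts)` is a state at the root together with a run on each subtree. -/
def TreeRun.nodeEquiv (s : σ) (ts : Fin (rk s) → RTree σ rk) :
    Q × ((i : Fin (rk s)) → TreeRun σ rk Q (ts i)) ≃ TreeRun σ rk Q (RTree.node s ts) where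
  toFun p := TreeRun.node p.1 p.2
  invFun r := match r with | TreeRun.node q rs => (q, rs)
  left_inv _ := rfl
  right_inv r := match r with | TreeRun.node _ _ => rfl

theorem TreeRun.fsum_node [Fintype Q] (s : σ) (ts : Fin (rk s) → RTree σ rk)
    (f : TreeRun σ rk Q (RTree.node s ts) → B) :
    S.fsum Finset.univ f = S.fsum Finset.univ (fun q => S.fsum Finset.univ
      (fun rs : (i : Fin (rk s)) → TreeRun σ rk Q (ts i) => f (TreeRun.node q rs))) := by
  rw [← S.fsum_equiv (TreeRun.nodeEquiv s ts) (fun p => f (TreeRun.node p.1 p.2)) f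
    (fun _ => rfl), S.fsum_prod]

theorem treeWt_node (δ : (s : σ) → (Fin (rk s) → Q) → Q → B) {s : σ}
    {ts : Fin (rk s) → RTree σ rk} (q : Q) (rs : (i : Fin (rk s)) → TreeRun σ rk Q (ts i)) :
    treeWt S δ (RTree.node s ts) (TreeRun.node q rs) =
      S.mul (S.finProd (fun i => treeWt S δ (ts i) (rs i))) (δ s (fun i => (rs i).root) q) :=
  rfl

theorem treeH_node [Fintype Q] (δ : (s : σ) → (Fin (rk s) → Q) → Q → B) (s : σ)
    (ts : Fin (rk s) → RTree σ rk) (q : Q) :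
    treeH S δ (RTree.node s ts) q = S.fsum Finset.univ (fun qs : Fin (rk s) → Q =>
      S.mul (S.finProd (fun i => treeH S δ (ts i) (qs i))) (δ s qs q)) :=
  rfl

/-- Each component of `h` is the sum of the weights of the runs ending in that state. -/
theorem treeH_eq_fsum [Fintype Q] [DecidableEq Q]
    (hr : ∀ s : σ, 1 ≤ rk s → S.RightDistributive)
    (hl : ∀ s : σ, 2 ≤ rk s → S.LeftDistributive)
    (δ : (s : σ) → (Fin (rk s) → Q) → Q → B) (t : RTree σ rk) (q : Q) :
    treeH S δ t q = S.fsum Finset.univ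
      (fun ρ : TreeRun σ rk Q t => if ρ.root = q then treeWt S δ t ρ else S.zero) := by
  induction t generalizing q with
  | node s ts ih =>
    have key (qs : Fin (rk s) → Q) :
        S.mul (S.finProd (fun i => treeH S δ (ts i) (qs i))) (δ s qs q) =
          S.fsum Finset.univ (fun rs : (i : Fin (rk s)) → TreeRun σ rk Q (ts i) =>
            if qs = fun i => (rs i).root then
              S.mul (S.finProd (fun i => treeWt S δ (ts i) (rs i))) (δ s qs q)
            else S.zero) := by
      have mulδ (f : ((i : Fin (rk s)) → TreeRun σ rk Q (ts i)) → B) :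
          S.mul (S.fsum Finset.univ f) (δ s qs q) =
            S.fsum Finset.univ (fun rs => S.mul (f rs) (δ s qs q)) := by
        rcases Nat.eq_zero_or_pos (rk s) with h | h
        · have : IsEmpty (Fin (rk s)) := by rw [h]; infer_instance
          rw [S.fsum_unique, S.fsum_unique]
        · exact (hr s h).fsum_mul _ _
      simp only [ih]
      rw [StrongBimonoid.finProd_fsum (hr s) (hl s), mulδ]
      refine S.fsum_congr fun rs => ?_
      rw [S.finProd_ite (fun i => (rs i).root = qs i)]
      simp only [funext_iff, eq_comm]
      split_ifs
      · rfl
      · exact (S.zero_mul _).symm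
    rw [treeH_node, TreeRun.fsum_node, S.fsum_eq_single q, S.fsum_congr key, S.fsum_comm]
    · refine S.fsum_congr fun rs => ?_
      rw [S.fsum_eq_single (fun i => (rs i).root) fun y hy => if_neg hy, if_pos rfl]
      exact (if_pos rfl).symm
    · intro y hy
      let := S.acm
      exact Finset.sum_eq_zero fun rs _ => if_neg hy

theorem treeRunSem_eq_treeInitSem_of_rightDistributive [Fintype Q]
    (hr : S.RightDistributive) (hl : ∀ s : σ, 2 ≤ rk s → S.LeftDistributive)
    (δ : (s : σ) → (Fin (rk s) → Q) → Q → B) (F : Q → B) :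
    treeRunSem S δ F = treeInitSem S δ F := by
  classical
  funext t
  rw [treeInitSem, treeRunSem]
  simp only [treeH_eq_fsum (fun _ _ => hr) hl, hr.fsum_mul]
  rw [S.fsum_comm]
  refine S.fsum_congr fun ρ => ?_
  rw [S.fsum_eq_single ρ.root, if_pos rfl]
  intro q hq
  rw [if_neg (Ne.symm hq), S.zero_mul]

theorem treeRunSem_eq_treeInitSem_of_rankTrivial [Fintype Q] (h : RankTrivial rk)
    (δ : (s : σ) → (Fin (rk s) → Q) → Q → B) (F : Q → B) :
    treeRunSem S δ F = treeInitSem S δ F := by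
  funext t
  obtain ⟨s, ts⟩ := t
  have : IsEmpty (Fin (rk s)) := by rw [h s]; infer_instance
  rw [treeInitSem, treeRunSem, TreeRun.fsum_node]
  refine S.fsum_congr fun q => ?_
  rw [S.fsum_unique, treeH_node, S.fsum_unique, treeWt_node,
    S.finProd_eq_one fun i => isEmptyElim i, S.finProd_eq_one fun i => isEmptyElim i]
  exact congrArg (fun qs => S.mul (S.mul S.one (δ s qs q)) (F q)) (Subsingleton.elim _ _)

end Trees

/-! An automaton that detects failures of distributivity -/

namespace DistribAutomaton

variable {B σ : Type} {rk : σ → ℕ} (S : StrongBimonoid B) (a b c : B)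

/-- The weights of the states at leaves. -/
def leafWt (q : Fin 6) : B :=
  if q = 0 then S.one else if q = 1 then b else if q = 2 then c else if q = 3 then a else S.zero

/-- The children's states `x, 0, …, 0`. -/
def headVec (k : ℕ) (x : Fin 6) : Fin k → Fin 6 := fun i => if i.val = 0 then x else 0

/-- The children's states `3, 4, 0, …, 0`. -/
def topVec (k : ℕ) : Fin k → Fin 6 :=
  fun i => if i.val = 0 then 3 else if i.val = 1 then 4 else 0

/-- From children's states `x, 0, …, 0` the automaton may move to `q`. -/
def Step (x q : Fin 6) : Prop :=
  (x = 0 ∧ q = 0) ∨ (x = 3 ∧ q = 3) ∨ (x = 1 ∧ q = 4) ∨ (x = 2 ∧ q = 4)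

open Classical in
/-- The transition weights. -/
noncomputable def delta (s : σ) (qs : Fin (rk s) → Fin 6) (q : Fin 6) : B :=
  if rk s = 0 then leafWt S a b c q
  else if (∃ x, Step x q ∧ qs = headVec (rk s) x) ∨ (q = 5 ∧ qs = topVec (rk s)) then S.one
  else S.zero

/-- The tree consisting of a nullary symbol. -/
def leaf {α : σ} (h : rk α = 0) : RTree σ rk :=
  RTree.node α fun i => (Fin.cast h i).elim0

/-- The tree `s(α, …, α)`. -/
def lowTree {α : σ} (h : rk α = 0) (s : σ) : RTree σ rk :=
  RTree.node s fun _ => leaf h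

/-- The tree `s(t, …, t)` with `t = s(α, …, α)`. -/
def highTree {α : σ} (h : rk α = 0) (s : σ) : RTree σ rk :=
  RTree.node s fun _ => lowTree h s

/-- The run on the leaf with state `q`. -/
def leafRun {α : σ} (h : rk α = 0) (q : Fin 6) : TreeRun σ rk (Fin 6) (leaf h) :=
  TreeRun.node q fun i => (Fin.cast h i).elim0

/-- The run on `s(α, …, α)` with states `x, 0, …, 0` at the leaves and `q` at the root. -/
def lowRun {α : σ} (h : rk α = 0) (s : σ) (x q : Fin 6) :
    TreeRun σ rk (Fin 6) (lowTree h s) :=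
  TreeRun.node q fun i => leafRun h (headVec (rk s) x i)

/-- The run on the high tree that uses the run `x, 0, …, 0` below its second child. -/
def highRun {α : σ} (h : rk α = 0) (s : σ) (x : Fin 6) :
    TreeRun σ rk (Fin 6) (highTree h s) :=
  TreeRun.node 5 fun i =>
    if i.val = 0 then lowRun h s 3 3 else if i.val = 1 then lowRun h s x 4 else lowRun h s 0 0

variable {α : σ} (h : rk α = 0) {s : σ}

theorem delta_of_step (hs : 1 ≤ rk s) {x q : Fin 6} (hx : Step x q) :
    delta S a b c s (headVec (rk s) x) q = S.one := by
  rw [delta, if_neg (by omega), if_pos (Or.inl ⟨x, hx, rfl⟩)]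

theorem delta_top (hs : 1 ≤ rk s) : delta S a b c s (topVec (rk s)) 5 = S.one := by
  rw [delta, if_neg (by omega), if_pos (Or.inr ⟨rfl, rfl⟩)]

theorem delta_ne_zero (hs : 1 ≤ rk s) {qs : Fin (rk s) → Fin 6} {q : Fin 6}
    (hd : delta S a b c s qs q ≠ S.zero) :
    (∃ x, Step x q ∧ qs = headVec (rk s) x) ∨ (q = 5 ∧ qs = topVec (rk s)) := by
  by_contra hn
  exact hd (by rw [delta, if_neg (by omega), if_neg hn])

theorem headVec_ne {k : ℕ} (hk : 1 ≤ k) {x y : Fin 6} (hxy : x ≠ y) :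
    headVec k x ≠ headVec k y := fun he => hxy (by simpa [headVec] using congrFun he ⟨0, hk⟩)

theorem finProd_headVec (hs : 1 ≤ rk s) {f : Fin 6 → B} (hf : f 0 = S.one) (x : Fin 6) :
    S.finProd (fun i => f (headVec (rk s) x i)) = f x := by
  rw [S.finProd_eq_head hs]
  · simp [headVec]
  · intro i hi
    rw [headVec, if_neg (by omega), hf]

theorem treeH_leaf (q : Fin 6) :
    treeH S (delta S a b c) (leaf h) q = leafWt S a b c q := by
  have : IsEmpty (Fin (rk α)) := by rw [h]; infer_instance
  rw [leaf, treeH_node, S.fsum_unique, S.finProd_eq_one fun i => isEmptyElim i, S.one_mul, delta,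
    if_pos h]

theorem treeWt_leafRun (q : Fin 6) :
    treeWt S (delta S a b c) (leaf h) (leafRun h q) = leafWt S a b c q := by
  have : IsEmpty (Fin (rk α)) := by rw [h]; infer_instance
  refine (treeWt_node _ _ _).trans ?_
  rw [S.finProd_eq_one fun i => isEmptyElim i, S.one_mul, delta, if_pos h]

theorem eq_leafRun (ρ : TreeRun σ rk (Fin 6) (leaf h)) : ρ = leafRun h ρ.root := by
  have : IsEmpty (Fin (rk α)) := by rw [h]; infer_instance
  obtain ⟨q, rs⟩ := ρ
  exact congrArg (TreeRun.node q) (Subsingleton.elim _ _)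

theorem treeH_lowTree_of_unique (hs : 1 ≤ rk s) {x q : Fin 6} (hx : Step x q) (hq : q ≠ 5)
    (hu : ∀ y, Step y q → y = x) :
    treeH S (delta S a b c) (lowTree h s) q = leafWt S a b c x := by
  rw [lowTree, treeH_node]
  simp only [treeH_leaf]
  rw [S.fsum_eq_single (headVec (rk s) x), delta_of_step S a b c hs hx, S.mul_one,
    finProd_headVec S hs rfl]
  intro qs hqs
  by_contra hn
  rcases delta_ne_zero S a b c hs (fun h0 => hn (by rw [h0, S.mul_zero])) with
    ⟨y, hy, rfl⟩ | ⟨h5, -⟩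
  · exact hqs (by rw [hu y hy])
  · exact hq h5

theorem treeH_lowTree_four (hs : 1 ≤ rk s) :
    treeH S (delta S a b c) (lowTree h s) 4 = S.add b c := by
  rw [lowTree, treeH_node]
  simp only [treeH_leaf]
  rw [S.fsum_eq_add (headVec (rk s) 1) (headVec (rk s) 2) (headVec_ne hs (by decide)),
    delta_of_step S a b c hs (by simp [Step]), delta_of_step S a b c hs (by simp [Step]),
    S.mul_one, S.mul_one, finProd_headVec S hs rfl, finProd_headVec S hs rfl]
  · simp [leafWt]
  rintro qs ⟨h1, h2⟩
  by_contra hn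
  rcases delta_ne_zero S a b c hs (fun h0 => hn (by rw [h0, S.mul_zero])) with
    ⟨y, hy, rfl⟩ | ⟨h5, -⟩
  · rcases hy with hy | hy | hy | hy
    · exact absurd hy.2 (by decide)
    · exact absurd hy.2 (by decide)
    · exact h1 (by rw [hy.1])
    · exact h2 (by rw [hy.1])
  · exact absurd h5 (by decide)

theorem treeH_highTree (hs : 2 ≤ rk s) :
    treeH S (delta S a b c) (highTree h s) 5 = S.mul a (S.add b c) := by
  have hs' : 1 ≤ rk s := by omega
  have h0 : treeH S (delta S a b c) (lowTree h s) 0 = S.one :=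
    treeH_lowTree_of_unique S a b c h hs' (x := 0) (by simp [Step]) (by decide)
      (by simp [Step])
  have h3 : treeH S (delta S a b c) (lowTree h s) 3 = a :=
    treeH_lowTree_of_unique S a b c h hs' (x := 3) (by simp [Step]) (by decide)
      (by simp [Step])
  rw [highTree, treeH_node, S.fsum_eq_single (topVec (rk s)), delta_top S a b c hs', S.mul_one,
    S.finProd_eq_mul hs]
  · simp [topVec, h3, treeH_lowTree_four S a b c h hs']
  · intro i hi
    rw [topVec, if_neg (by omega), if_neg (by omega), h0]
  · intro qs hqs
    by_contra hn
    rcases delta_ne_zero S a b c hs' (fun h0 => hn (by rw [h0, S.mul_zero])) with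
      ⟨y, hy, -⟩ | ⟨-, ht⟩
    · simp [Step] at hy
    · exact hqs ht

theorem treeWt_lowRun (hs : 1 ≤ rk s) {x q : Fin 6} (hx : Step x q) :
    treeWt S (delta S a b c) (lowTree h s) (lowRun h s x q) = leafWt S a b c x := by
  refine (treeWt_node _ _ _).trans ?_
  simp only [treeWt_leafRun]
  rw [finProd_headVec S hs rfl]
  exact (congrArg _ (delta_of_step S a b c hs hx)).trans (S.mul_one _)

theorem eq_lowRun (hs : 1 ≤ rk s) (ρ : TreeRun σ rk (Fin 6) (lowTree h s))
    (hρ : treeWt S (delta S a b c) (lowTree h s) ρ ≠ S.zero) (h5 : ρ.root ≠ 5) :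
    ∃ x, Step x ρ.root ∧ ρ = lowRun h s x ρ.root := by
  obtain ⟨q, rs⟩ := ρ
  rcases delta_ne_zero S a b c hs (fun h0 => hρ ((treeWt_node _ _ _).trans (by rw [h0, S.mul_zero]))) with
    ⟨x, hx, hv⟩ | ⟨hq, -⟩
  · refine ⟨x, hx, congrArg (TreeRun.node q) (funext fun i => ?_)⟩
    rw [eq_leafRun h (rs i), ← hv]
  · exact absurd hq h5

theorem lowRun_ne (hs : 1 ≤ rk s) {x y : Fin 6} (hxy : x ≠ y) (q : Fin 6) :
    lowRun h s x q ≠ lowRun h s y q := by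
  intro he
  have h1 := congrFun (TreeRun.node.inj he).2 ⟨0, hs⟩
  exact hxy (by simpa [headVec, leafRun, TreeRun.root] using congrArg TreeRun.root h1)

theorem treeRunSem_lowTree (hs : 1 ≤ rk s) (d : B) :
    treeRunSem S (delta S a b c) (fun q => if q = 4 then d else S.zero) (lowTree h s) =
      S.add (S.mul b d) (S.mul c d) := by
  rw [treeRunSem, S.fsum_eq_add (lowRun h s 1 4) (lowRun h s 2 4)
    (lowRun_ne h hs (by decide) 4), treeWt_lowRun S a b c h hs (by simp [Step]),
    treeWt_lowRun S a b c h hs (by simp [Step])]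
  · simp [leafWt, lowRun, TreeRun.root]
  rintro ρ ⟨h1, h2⟩
  by_contra hn
  have hq : ρ.root = 4 := by
    by_contra hq
    exact hn (by rw [if_neg hq, S.mul_zero])
  obtain ⟨x, hx, he⟩ := eq_lowRun S a b c h hs ρ (fun h0 => hn (by rw [h0, S.zero_mul]))
    (by rw [hq]; decide)
  rw [hq] at hx he
  rcases hx with hx | hx | hx | hx
  · exact absurd hx.2 (by decide)
  · exact absurd hx.2 (by decide)
  · exact h1 (by rw [he, hx.1])
  · exact h2 (by rw [he, hx.1])

theorem treeInitSem_eq (q : Fin 6) (d : B) (t : RTree σ rk) :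
    treeInitSem S (delta S a b c) (fun p => if p = q then d else S.zero) t =
      S.mul (treeH S (delta S a b c) t q) d := by
  rw [treeInitSem, S.fsum_eq_single q, if_pos rfl]
  intro p hp
  rw [if_neg hp, S.mul_zero]

theorem treeWt_highRun (hs : 2 ≤ rk s) {x : Fin 6} (hx : Step x 4) :
    treeWt S (delta S a b c) (highTree h s) (highRun h s x) = S.mul a (leafWt S a b c x) := by
  have hs' : 1 ≤ rk s := by omega
  have hv : (fun i : Fin (rk s) => TreeRun.root (if i.val = 0 then lowRun h s 3 3
      else if i.val = 1 then lowRun h s x 4 else lowRun h s 0 0)) = topVec (rk s) := by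
    funext i
    rw [topVec]
    split_ifs <;> rfl
  refine (treeWt_node _ _ _).trans ?_
  rw [hv, delta_top S a b c hs', S.mul_one, S.finProd_eq_mul hs]
  · simp only [if_true, one_ne_zero, if_false]
    rw [treeWt_lowRun S a b c h hs' hx, treeWt_lowRun S a b c h hs' (by simp [Step])]
    simp [leafWt]
  · intro i hi
    rw [if_neg (by omega), if_neg (by omega), treeWt_lowRun S a b c h hs' (by simp [Step])]
    rfl

theorem eq_highRun (hs : 2 ≤ rk s) (ρ : TreeRun σ rk (Fin 6) (highTree h s))
    (hρ : treeWt S (delta S a b c) (highTree h s) ρ ≠ S.zero) (h5 : ρ.root = 5) :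
    ρ = highRun h s 1 ∨ ρ = highRun h s 2 := by
  have hs' : 1 ≤ rk s := by omega
  obtain ⟨q, rs⟩ := ρ
  obtain rfl : q = 5 := h5
  rcases delta_ne_zero S a b c hs' (fun h0 => hρ ((treeWt_node _ _ _).trans (by rw [h0, S.mul_zero]))) with
    ⟨x, hx, -⟩ | ⟨-, hv⟩
  · simp [Step] at hx
  have hroot (i : Fin (rk s)) : (rs i).root = topVec (rk s) i := congrFun hv i
  have hlow (i : Fin (rk s)) :
      ∃ x, Step x (topVec (rk s) i) ∧ rs i = lowRun h s x (topVec (rk s) i) := by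
    rw [← hroot i]
    refine eq_lowRun S a b c h hs' _ (fun h0 => hρ ?_) ?_
    · exact (treeWt_node _ _ _).trans (by rw [S.finProd_eq_zero i h0, S.zero_mul])
    · rw [hroot, topVec]
      split_ifs <;> decide
  obtain ⟨x, hx, he⟩ := hlow ⟨1, hs⟩
  have hρx : TreeRun.node 5 rs = highRun h s x := by
    refine congrArg (TreeRun.node 5) (funext fun i => ?_)
    obtain ⟨y, hy, hi⟩ := hlow i
    rw [topVec] at hy hi
    split_ifs at hy hi ⊢ with h0 h1
    · rw [hi, show y = 3 by simpa [Step] using hy]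
    · obtain rfl : i = ⟨1, hs⟩ := Fin.ext h1
      exact he
    · rw [hi, show y = 0 by simpa [Step] using hy]
  have hx12 : x = 1 ∨ x = 2 := by simpa [Step, topVec] using hx
  exact hx12.imp (fun e => by rw [hρx, e]) (fun e => by rw [hρx, e])

theorem treeRunSem_highTree (hs : 2 ≤ rk s) :
    treeRunSem S (delta S a b c) (fun q => if q = 5 then S.one else S.zero) (highTree h s) =
      S.add (S.mul a b) (S.mul a c) := by
  have hne : highRun h s 1 ≠ highRun h s 2 := by
    intro he
    have h1 := congrFun (TreeRun.node.inj he).2 ⟨1, hs⟩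
    simp only [one_ne_zero, if_true, if_false] at h1
    exact lowRun_ne h (by omega) (by decide) 4 h1
  rw [treeRunSem, S.fsum_eq_add _ _ hne, treeWt_highRun S a b c h hs (by simp [Step]),
    treeWt_highRun S a b c h hs (by simp [Step])]
  · simp [leafWt, highRun, TreeRun.root, S.mul_one]
  rintro ρ ⟨h1, h2⟩
  by_contra hn
  rcases eq_highRun S a b c h hs ρ (fun h0 => hn (by rw [h0, S.zero_mul]))
    (by by_contra hq; exact hn (by rw [if_neg hq, S.mul_zero])) with he | he
  · exact h1 he
  · exact h2 he

end DistribAutomaton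

theorem stmt17 {B : Type} (S : StrongBimonoid B)
    (σt : Type) [Fintype σt] [Nonempty σt] (rk : σt → ℕ) (h0 : ∃ s, rk s = 0) :
    ((¬ RankTrivial rk → S.RightDistributive) ∧
      (RankBranching rk → S.LeftDistributive)) ↔
      (∀ (Q : Type) [Fintype Q] [Nonempty Q] (δ : (s : σt) → (Fin (rk s) → Q) → Q → B) (F : Q → B),
        treeRunSem S δ F = treeInitSem S δ F) := by
  constructor
  · rintro ⟨hr, hl⟩ Q _ _ δ F
    by_cases ht : RankTrivial rk
    · exact treeRunSem_eq_treeInitSem_of_rankTrivial ht δ F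
    · exact treeRunSem_eq_treeInitSem_of_rightDistributive (hr ht) (fun s hs => hl ⟨s, hs⟩) δ F
  · intro H
    obtain ⟨α, hα⟩ := h0
    constructor
    · intro ht b c d
      obtain ⟨s, hs⟩ := not_forall.mp ht
      have hs' : 1 ≤ rk s := Nat.one_le_iff_ne_zero.mpr hs
      have key := congrFun (H (Fin 6) (DistribAutomaton.delta S S.zero b c)
        (fun q => if q = 4 then d else S.zero)) (DistribAutomaton.lowTree hα s)
      rw [DistribAutomaton.treeRunSem_lowTree S _ b c hα hs', DistribAutomaton.treeInitSem_eq,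
        DistribAutomaton.treeH_lowTree_four S _ b c hα hs'] at key
      exact key.symm
    · rintro ⟨s, hs⟩ a b c
      have key := congrFun (H (Fin 6) (DistribAutomaton.delta S a b c)
        (fun q => if q = 5 then S.one else S.zero)) (DistribAutomaton.highTree hα s)
      rw [DistribAutomaton.treeRunSem_highTree S a b c hα hs, DistribAutomaton.treeInitSem_eq,
        DistribAutomaton.treeH_highTree S a b c hα hs, S.mul_one] at key
      exact key.symm
end
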